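/- Let N be a unitarily invariant norm on the n×n complex matrices and let α ∈ [0, π/2). If X ∈ M_n has numerical range W(X) contained in the sector S_α, then ω_N(X) ≤ sec(α) · ω_N(Re(X)). -/

import Mathlib

open scoped ComplexOrder Matrix

/-- The Hermitian (real) part of a matrix: `Re(X) = (X + X*)/2`. -/
noncomputable def matRe {n : ℕ} (X : Matrix (Fin n) (Fin n) ℂ) :
    Matrix (Fin n) (Fin n) ℂ :=
  (1 / 2 : ℂ) • (X + Xᴴ)

/-- The skew (imaginary) part of a matrix: `Im(X) = (X - X*)/(2i)`. -/
noncomputable def matIm {n : ℕ} (X : Matrix (Fin n) (Fin n) ℂ) :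
    Matrix (Fin n) (Fin n) ℂ :=
  (1 / (2 * Complex.I)) • (X - Xᴴ)

/-- The generalized numerical radius induced by a norm `N`:
`ω_N(X) = sup_θ N(Re(e^{iθ} X))`. -/
noncomputable def gnr {n : ℕ} (N : Matrix (Fin n) (Fin n) ℂ → ℝ)
    (X : Matrix (Fin n) (Fin n) ℂ) : ℝ :=
  ⨆ θ : ℝ, N (matRe (Complex.exp (θ * Complex.I) • X))

/-- The numerical range `W(X) = {⟨Xx, x⟩ : ‖x‖ = 1}` (standard inner product on ℂⁿ). -/
def numRange {n : ℕ} (X : Matrix (Fin n) (Fin n) ℂ) : Set ℂ :=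
  { z | ∃ x : Fin n → ℂ, star x ⬝ᵥ x = 1 ∧ z = star x ⬝ᵥ X.mulVec x }

/-- The sector `S_α = {z : Re z > 0, |Im z| ≤ tan(α) Re z}`. -/
def sector (α : ℝ) : Set ℂ :=
  { z | 0 < z.re ∧ |z.im| ≤ Real.tan α * z.re }

/-- The class `M^s_{n,α}` of matrices `X` such that `W(zX) ⊆ S_α` for some unimodular `z`. -/
def sectClass (n : ℕ) (α : ℝ) : Set (Matrix (Fin n) (Fin n) ℂ) :=
  { X | ∃ z : ℂ, ‖z‖ = 1 ∧ numRange (z • X) ⊆ sector α }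


theorem aux_nonneg {n : ℕ} (N : Matrix (Fin n) (Fin n) ℂ → ℝ)
    (hN0 : ∀ A : Matrix (Fin n) (Fin n) ℂ, N A = 0 ↔ A = 0)
    (hNs : ∀ (c : ℂ) (A : Matrix (Fin n) (Fin n) ℂ), N (c • A) = ‖c‖ * N A)
    (hNa : ∀ A B : Matrix (Fin n) (Fin n) ℂ, N (A + B) ≤ N A + N B)
    (A : Matrix (Fin n) (Fin n) ℂ) : 0 ≤ N A := by
  have h1 := hNa A ((-1 : ℂ) • A)
  have h2 : A + (-1 : ℂ) • A = 0 := by simp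
  rw [h2, (hN0 0).2 rfl, hNs] at h1
  simp at h1
  linarith

theorem aux_half {n : ℕ} (N : Matrix (Fin n) (Fin n) ℂ → ℝ)
    (hNs : ∀ (c : ℂ) (A : Matrix (Fin n) (Fin n) ℂ), N (c • A) = ‖c‖ * N A)
    (hNa : ∀ A B : Matrix (Fin n) (Fin n) ℂ, N (A + B) ≤ N A + N B)
    (A B : Matrix (Fin n) (Fin n) ℂ) : N ((1 / 2 : ℂ) • (A + B)) ≤ (N A + N B) / 2 := by
  rw [hNs]
  have := hNa A B
  norm_num
  linarith

theorem aux_diag_unitary {n : ℕ} (v : Fin n → ℂ) (hv : ∀ i, star (v i) * v i = 1) :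
    Matrix.diagonal v ∈ Matrix.unitaryGroup (Fin n) ℂ := by
  rw [Matrix.mem_unitaryGroup_iff', Matrix.star_eq_conjTranspose, Matrix.diagonal_conjTranspose,
    Matrix.diagonal_mul_diagonal, ← Matrix.diagonal_one]
  congr 1
  funext i
  exact hv i

theorem aux_contr {n : ℕ} (N : Matrix (Fin n) (Fin n) ℂ → ℝ)
    (hNs : ∀ (c : ℂ) (A : Matrix (Fin n) (Fin n) ℂ), N (c • A) = ‖c‖ * N A)
    (hNa : ∀ A B : Matrix (Fin n) (Fin n) ℂ, N (A + B) ≤ N A + N B)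
    (hUI : ∀ U V A : Matrix (Fin n) (Fin n) ℂ, U ∈ Matrix.unitaryGroup (Fin n) ℂ →
      V ∈ Matrix.unitaryGroup (Fin n) ℂ → N (U * A * V) = N A)
    (t : Fin n → ℝ) (ht : ∀ i, |t i| ≤ 1) (Q : Matrix (Fin n) (Fin n) ℂ) :
    N (Matrix.diagonal (fun i => (t i : ℂ)) * Q) ≤ N Q := by
  have hsq : ∀ i, 0 ≤ 1 - t i ^ 2 := fun i => by
    have := (sq_le_one_iff_abs_le_one (t i)).2 (ht i)
    linarith
  set v : Fin n → ℂ := fun i => ⟨t i, √(1 - t i ^ 2)⟩ with hv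
  have hs : ∀ i, √(1 - t i ^ 2) * √(1 - t i ^ 2) = 1 - t i ^ 2 :=
    fun i => Real.mul_self_sqrt (hsq i)
  have h1 : ∀ i, star (v i) * v i = 1 := fun i => by
    apply Complex.ext <;> simp [hv, hs] <;> ring
  have h2 : ∀ i, star (star (v i)) * star (v i) = 1 := fun i => by
    rw [star_star, mul_comm]; exact h1 i
  have e : Matrix.diagonal (fun i => (t i : ℂ)) * Q = (1 / 2 : ℂ) •
      (Matrix.diagonal v * Q * 1 + Matrix.diagonal (fun i => star (v i)) * Q * 1) := by
    ext i j
    have : (t i : ℂ) = (1 / 2 : ℂ) * (v i + star (v i)) := by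
      apply Complex.ext <;> simp [hv] <;> ring
    simp only [mul_one, Matrix.smul_apply, Matrix.add_apply, Matrix.diagonal_mul, smul_eq_mul]
    rw [this]; ring
  rw [e]
  refine (aux_half N hNs hNa _ _).trans ?_
  rw [hUI _ _ _ (aux_diag_unitary _ h1) (one_mem _), hUI _ _ _ (aux_diag_unitary _ h2) (one_mem _)]
  linarith

theorem aux_pinch {n : ℕ} (N : Matrix (Fin n) (Fin n) ℂ → ℝ)
    (hNs : ∀ (c : ℂ) (A : Matrix (Fin n) (Fin n) ℂ), N (c • A) = ‖c‖ * N A)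
    (hNa : ∀ A B : Matrix (Fin n) (Fin n) ℂ, N (A + B) ≤ N A + N B)
    (hUI : ∀ U V A : Matrix (Fin n) (Fin n) ℂ, U ∈ Matrix.unitaryGroup (Fin n) ℂ →
      V ∈ Matrix.unitaryGroup (Fin n) ℂ → N (U * A * V) = N A)
    (P : Matrix (Fin n) (Fin n) ℂ) (s : Finset (Fin n)) :
    N (Matrix.of fun i j => if i = j ∨ (i ∉ s ∧ j ∉ s) then P i j else 0) ≤ N P := by
  induction s using Finset.induction_on with
  | empty => 
    apply le_of_eq
    congr 1
    ext i j
    simp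
  | insert a s ha ih =>
    set Q : Matrix (Fin n) (Fin n) ℂ :=
      Matrix.of fun i j => if i = j ∨ (i ∉ s ∧ j ∉ s) then P i j else 0 with hQ
    set v : Fin n → ℂ := fun i => if i = a then -1 else 1 with hv
    have h1 : ∀ i, star (v i) * v i = 1 := fun i => by
      by_cases h : i = a <;> simp [hv, h]
    have hu := aux_diag_unitary _ h1
    have e : (Matrix.of fun i j => if i = j ∨ (i ∉ insert a s ∧ j ∉ insert a s)
        then P i j else 0) = (1 / 2 : ℂ) • (Q + Matrix.diagonal v * Q * Matrix.diagonal v) := by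
      ext i j
      simp only [Matrix.smul_apply, Matrix.add_apply, Matrix.diagonal_mul, smul_eq_mul,
        Matrix.mul_diagonal, hQ, Matrix.of_apply, hv, Finset.mem_insert]
      by_cases hij : i = j
      · subst hij
        by_cases h : i = a <;> simp [h] <;> ring
      · by_cases h : i = a
        · have : j ≠ a := fun h' => hij (h.trans h'.symm)
          have h3 : a ≠ j := this.symm
          simp [h, this, h3]
          split_ifs <;> ring
        · by_cases h' : j = a
          · simp [h, h']
          · simp [h, h', hij]
            split_ifs <;> ring
    rw [e]
    refine (aux_half N hNs hNa _ _).trans ?_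
    rw [hUI _ _ _ hu hu]
    linarith

theorem aux_diag {n : ℕ} (N : Matrix (Fin n) (Fin n) ℂ → ℝ)
    (hNs : ∀ (c : ℂ) (A : Matrix (Fin n) (Fin n) ℂ), N (c • A) = ‖c‖ * N A)
    (hNa : ∀ A B : Matrix (Fin n) (Fin n) ℂ, N (A + B) ≤ N A + N B)
    (hUI : ∀ U V A : Matrix (Fin n) (Fin n) ℂ, U ∈ Matrix.unitaryGroup (Fin n) ℂ →
      V ∈ Matrix.unitaryGroup (Fin n) ℂ → N (U * A * V) = N A)
    (P : Matrix (Fin n) (Fin n) ℂ) :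
    N (Matrix.diagonal fun i => P i i) ≤ N P := by
  convert aux_pinch N hNs hNa hUI P Finset.univ using 2
  ext i j
  by_cases h : i = j <;> simp [h]

theorem aux_conj {n : ℕ} (U X : Matrix (Fin n) (Fin n) ℂ) :
    Uᴴ * matRe X * U = matRe (Uᴴ * X * U) := by
  simp [matRe, Matrix.mul_add, Matrix.add_mul, Matrix.mul_assoc]

theorem aux_matRe_diag {n : ℕ} (X : Matrix (Fin n) (Fin n) ℂ) (i : Fin n) :
    matRe X i i = ((X i i).re : ℂ) := by
  simp [matRe, Complex.re_eq_add_conj]; ring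

theorem aux_matRe_herm {n : ℕ} (X : Matrix (Fin n) (Fin n) ℂ) : (matRe X).IsHermitian := by
  simp [matRe, Matrix.IsHermitian, add_comm]

theorem aux_sector {α : ℝ} (hα0 : 0 ≤ α) (hα1 : α < Real.pi / 2) {z : ℂ} (hz : z ∈ sector α) :
    Real.cos α * ‖z‖ ≤ z.re := by
  obtain ⟨h1, h2⟩ := hz
  have hc : 0 < Real.cos α := Real.cos_pos_of_mem_Ioo ⟨by linarith [Real.pi_pos], hα1⟩
  rw [Real.tan_eq_sin_div_cos] at h2
  have h3 : Real.cos α * |z.im| ≤ Real.sin α * z.re := by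
    calc _ ≤ Real.cos α * (Real.sin α / Real.cos α * z.re) := by gcongr
      _ = _ := by field_simp
  apply le_of_sq_le_sq _ h1.le
  rw [mul_pow, Complex.sq_norm, Complex.normSq_apply]
  have h4 : (Real.cos α * |z.im|) ^ 2 ≤ (Real.sin α * z.re) ^ 2 := by gcongr
  rw [mul_pow, mul_pow, sq_abs] at h4
  nlinarith [Real.sin_sq_add_cos_sq α]

theorem stmt_2 {n : ℕ} (N : Matrix (Fin n) (Fin n) ℂ → ℝ)
    (hN0 : ∀ A : Matrix (Fin n) (Fin n) ℂ, N A = 0 ↔ A = 0)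
    (hNs : ∀ (c : ℂ) (A : Matrix (Fin n) (Fin n) ℂ), N (c • A) = ‖c‖ * N A)
    (hNa : ∀ A B : Matrix (Fin n) (Fin n) ℂ, N (A + B) ≤ N A + N B)
    (hUI : ∀ U V A : Matrix (Fin n) (Fin n) ℂ, U ∈ Matrix.unitaryGroup (Fin n) ℂ →
      V ∈ Matrix.unitaryGroup (Fin n) ℂ → N (U * A * V) = N A)
    {α : ℝ} (hα0 : 0 ≤ α) (hα1 : α < Real.pi / 2)
    (X : Matrix (Fin n) (Fin n) ℂ) (hX : numRange X ⊆ sector α) :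
    gnr N X ≤ (Real.cos α)⁻¹ * gnr N (matRe X) := by
  have hc : 0 < Real.cos α := Real.cos_pos_of_mem_Ioo ⟨by linarith [Real.pi_pos], hα1⟩
  have hb : BddAbove (Set.range fun θ : ℝ => N (matRe (Complex.exp (θ * Complex.I) • matRe X))) := by
    refine ⟨(N (matRe X) + N (matRe X)ᴴ) / 2, ?_⟩
    rintro _ ⟨θ, rfl⟩
    refine (aux_half N hNs hNa _ _).trans ?_
    rw [Matrix.conjTranspose_smul, hNs, hNs, norm_star, Complex.norm_exp_ofReal_mul_I]
    simp
  have h0 : N (matRe X) ≤ gnr N (matRe X) := by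
    have := le_ciSup hb 0
    have e : matRe (matRe X) = matRe X := by
      conv_lhs => rw [matRe, (aux_matRe_herm X).eq, ← two_smul ℂ, smul_smul]
      norm_num
    simpa [gnr, e] using this
  refine ciSup_le fun θ => ?_
  refine le_trans ?_ (mul_le_mul_of_nonneg_left h0 (inv_nonneg.2 hc.le))
  set w := Complex.exp (θ * Complex.I) with hw
  have hw1 : ‖w‖ = 1 := Complex.norm_exp_ofReal_mul_I θ
  have hH := aux_matRe_herm (w • X)
  set U : Matrix (Fin n) (Fin n) ℂ := (hH.eigenvectorUnitary : Matrix (Fin n) (Fin n) ℂ) with hU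
  have hUm : U ∈ Matrix.unitaryGroup (Fin n) ℂ := hH.eigenvectorUnitary.2
  have hUm' : Uᴴ ∈ Matrix.unitaryGroup (Fin n) ℂ := Unitary.star_mem hUm
  have hUU : Uᴴ * U = 1 := (Matrix.mem_unitaryGroup_iff').1 hUm
  set Y := Uᴴ * X * U with hY
  have hspec : matRe (w • Y) = Matrix.diagonal (fun i => ((hH.eigenvalues i : ℝ) : ℂ)) := by
    have e1 : matRe (w • Y) = Uᴴ * matRe (w • X) * U := by
      rw [aux_conj, hY]; simp
    rw [e1]
    have h := hH.spectral_theorem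
    rw [Unitary.conjStarAlgAut_apply] at h
    change matRe (w • X) = U * _ * Uᴴ at h
    conv_lhs => rw [h]
    rw [Matrix.mul_assoc, Matrix.mul_assoc, hUU, Matrix.mul_one, ← Matrix.mul_assoc, hUU,
      Matrix.one_mul]
    rfl
  have hsec : ∀ i, Y i i ∈ sector α := fun i => by
    apply hX
    refine ⟨fun k => U k i, ?_, ?_⟩
    · have := congrFun (congrFun hUU i) i
      rw [Matrix.mul_apply] at this
      simpa [dotProduct] using this
    · rw [hY, Matrix.mul_assoc, Matrix.mul_apply]
      rfl
  set t : Fin n → ℝ := fun i => Real.cos α * (w * Y i i).re / (Y i i).re with ht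
  have ht1 : ∀ i, |t i| ≤ 1 := fun i => by
    have h1 := aux_sector hα0 hα1 (hsec i)
    have hp := (hsec i).1
    rw [ht]
    simp only
    rw [abs_div, abs_mul, abs_of_pos hc, abs_of_pos hp, div_le_one hp]
    refine le_trans ?_ h1
    gcongr
    refine (Complex.abs_re_le_norm _).trans ?_
    rw [norm_mul, hw1, one_mul]
  have hD : matRe (w • Y) = (((Real.cos α)⁻¹ : ℝ) : ℂ) •
      (Matrix.diagonal (fun i => (t i : ℂ)) * Matrix.diagonal fun i => matRe Y i i) := by
    have hdiag : matRe (w • Y) = Matrix.diagonal (fun i => (matRe (w • Y)) i i) := by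
      rw [hspec]; simp
    rw [hdiag, Matrix.diagonal_mul_diagonal, ← Matrix.diagonal_smul]
    congr 1
    funext i
    have hp := (hsec i).1.ne'
    rw [aux_matRe_diag, Pi.smul_apply, aux_matRe_diag, smul_eq_mul, ← Complex.ofReal_mul,
      ← Complex.ofReal_mul, Complex.ofReal_inj, Matrix.smul_apply, smul_eq_mul, ht]
    field_simp
  have e2 : N (matRe (w • X)) = N (matRe (w • Y)) := by
    have e1 : matRe (w • Y) = Uᴴ * matRe (w • X) * U := by
      rw [aux_conj, hY]; simp
    rw [e1, hUI _ _ _ hUm' hUm]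
  have e3 : N (matRe Y) = N (matRe X) := by
    rw [hY, ← aux_conj, hUI _ _ _ hUm' hUm]
  rw [e2, hD, hNs, Complex.norm_real, Real.norm_of_nonneg (inv_nonneg.2 hc.le), ← e3]
  gcongr
  exact (aux_contr N hNs hNa hUI t ht1 _).trans (aux_diag N hNs hNa hUI _)
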